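/- Let m ≥ n − 1 ≥ 0 be integers. For every field F, every β ∈ F, all y_1, y_2, … ∈ F and all pairwise distinct x_1, …, x_n ∈ F, the factorial Grothendieck polynomial of the one-row partition (m−n+1) in n variables satisfies G_{(m−n+1)}(x_1,…,x_n|y) = Σ_{i=1}^n [x_i|y]^m · ∏_{j≠i} (1+βx_j)/(x_i − x_j). -/

import Mathlib

/-- `[x|y]^j = (x ⊕ y_1)⋯(x ⊕ y_j)` where `a ⊕ b = a + b + βab`; `y t` is `y_{t+1}`. -/
def fpow {F : Type*} [Field F] (β : F) (y : ℕ → F) (x : F) (j : ℕ) : F :=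
  ∏ t ∈ Finset.range j, (x + y t + β * x * y t)

/-- The factorial Grothendieck polynomial, given by the Ikeda–Naruse determinantal formula
`G_λ(x|y) = det([x_i|y]^{λ_j+n−j}(1+βx_i)^{j−1})_{1≤i,j≤n} / ∏_{i<j}(x_i − x_j)`. -/
noncomputable def Groth {F : Type*} [Field F] (β : F) (y : ℕ → F) {n : ℕ}
    (lam : Fin n → ℕ) (x : Fin n → F) : F :=
  (Matrix.of fun i j : Fin n =>
      fpow β y (x i) (lam j + (n - 1 - (j : ℕ))) * (1 + β * x i) ^ (j : ℕ)).det
    / ∏ i : Fin n, ∏ j ∈ Finset.Ioi i, (x i - x j)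

open Polynomial in
theorem scaleRoots_prod_X_add_C {ι F : Type*} [Field F] (s : Finset ι) (a : ι → F) (w : F) :
    (∏ t ∈ s, (X + C (a t))).scaleRoots w = ∏ t ∈ s, (X + C (a t * w)) := by
  classical
  induction s using Finset.induction_on with
  | empty => simp
  | insert i s hi ih =>
    rw [Finset.prod_insert hi, Finset.prod_insert hi, mul_scaleRoots_of_noZeroDivisors, ih,
      X_add_C_scaleRoots]

open Polynomial in
theorem natDegree_prod_range_X_add_C {F : Type*} [Field F] (y : ℕ → F) (k : ℕ) :
    (∏ t ∈ Finset.range k, (X + C (y t))).natDegree = k := by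
  simp [natDegree_prod_of_monic _ _ fun t _ => monic_X_add_C (y t)]

open Polynomial in
theorem fpow_eq_eval_scaleRoots {F : Type*} [Field F] (β : F) (y : ℕ → F) (x : F) (k : ℕ) :
    fpow β y x k =
      ((∏ t ∈ Finset.range k, (X + C (y t))).scaleRoots (1 + β * x)).eval x := by
  rw [scaleRoots_prod_X_add_C, eval_prod, fpow]
  refine Finset.prod_congr rfl fun t _ => ?_
  simp only [eval_add, eval_X, eval_C]
  ring

open Polynomial in
/-- The factorial Grothendieck polynomial of the empty partition is `1`, in determinantal form. -/
theorem det_fpow_mul_pow {F : Type*} [Field F] (β : F) (y : ℕ → F) {n : ℕ} (x : Fin n → F) :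
    (Matrix.of fun i j : Fin n =>
      fpow β y (x i) (n - 1 - (j : ℕ)) * (1 + β * x i) ^ (j : ℕ)).det
      = ∏ i : Fin n, ∏ j ∈ Finset.Ioi i, (x i - x j) := by
  let P : ℕ → F[X] := fun k => ∏ t ∈ Finset.range k, (X + C (y t))
  have hP : ∀ k, (P k).natDegree = k := natDegree_prod_range_X_add_C y
  have hmonic : ∀ k, (P k).Monic := fun k => monic_prod_of_monic _ _ fun t _ => monic_X_add_C (y t)
  let A : Matrix (Fin n) (Fin n) F := Matrix.of fun l j => (P (n - 1 - (j : ℕ))).coeff l.rev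
  have hA : A.det = 1 := by
    rw [Matrix.det_of_isLowerTriangular]
    · refine Finset.prod_eq_one fun j _ => ?_
      have : (j.rev : ℕ) = (P (n - 1 - (j : ℕ))).natDegree := by
        rw [hP, Fin.val_rev]; omega
      simp only [A, Matrix.of_apply]
      rw [this]
      exact hmonic _
    · intro l j hlj
      have hlt : l < j := hlj
      have hdeg : (P (n - 1 - (j : ℕ))).natDegree < (l.rev : ℕ) := by
        rw [hP, Fin.val_rev]; omega
      exact coeff_eq_zero_of_natDegree_lt hdeg
  have hmul : (Matrix.of fun i j : Fin n =>
      fpow β y (x i) (n - 1 - (j : ℕ)) * (1 + β * x i) ^ (j : ℕ))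
      = Matrix.projVandermonde (fun i => 1 + β * x i) x * A := by
    ext i j
    have hdeg : ((P (n - 1 - (j : ℕ))).scaleRoots (1 + β * x i)).natDegree < n := by
      rw [natDegree_scaleRoots, hP]; omega
    rw [Matrix.mul_apply, ← Equiv.sum_comp Fin.revPerm, Matrix.of_apply, fpow_eq_eval_scaleRoots,
      eval_eq_sum_range' hdeg, Finset.sum_mul, ← Fin.sum_univ_eq_sum_range
        (fun s => ((P (n - 1 - (j : ℕ))).scaleRoots (1 + β * x i)).coeff s * x i ^ s
          * (1 + β * x i) ^ (j : ℕ))]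
    refine Finset.sum_congr rfl fun s _ => ?_
    simp only [Fin.revPerm_apply, Matrix.projVandermonde_apply, Fin.rev_rev, A, Matrix.of_apply,
      coeff_scaleRoots, hP]
    by_cases hs : (s : ℕ) ≤ n - 1 - (j : ℕ)
    · have : (s.rev : ℕ) = (n - 1 - (j : ℕ) - s) + j := by
        rw [Fin.val_rev]; omega
      rw [this, pow_add]
      ring
    · rw [coeff_eq_zero_of_natDegree_lt (by rw [hP]; omega)]
      simp
  rw [hmul, Matrix.det_mul, hA, mul_one, Matrix.det_projVandermonde]
  refine Finset.prod_congr rfl fun i _ => Finset.prod_congr rfl fun j _ => ?_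
  ring

theorem prod_Ioi_sub_succAbove {R : Type*} [CommRing R] {n : ℕ} (x : Fin (n + 1) → R)
    (p : Fin (n + 1)) :
    ∏ i, ∏ j ∈ Finset.Ioi i, (x i - x j)
      = (-1) ^ (p : ℕ) * (∏ a, (x p - x (p.succAbove a)))
        * ∏ a, ∏ b ∈ Finset.Ioi a, (x (p.succAbove a) - x (p.succAbove b)) := by
  have hIoi : ∀ {k : ℕ} (i : Fin k) (f : Fin k → R),
      ∏ j ∈ Finset.Ioi i, f j = ∏ j, if i < j then f j else 1 := fun i f => by
    rw [← Finset.prod_filter]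
    congr 1
    ext
    simp
  have hsign : ∏ a : Fin n, (if p.succAbove a < p then (-1 : R) else 1) = (-1) ^ (p : ℕ) := by
    have : (Finset.univ.filter fun a : Fin n => p.succAbove a < p).card = (p : ℕ) := by
      simp only [Fin.succAbove_lt_iff_castSucc_lt]
      simp only [Fin.lt_def, Fin.val_castSucc]
      rw [Fin.card_filter_val_lt]
      omega
    rw [Finset.prod_ite, Finset.prod_const, this]
    simp
  simp only [hIoi]
  rw [Fin.prod_univ_succAbove _ p, Fin.prod_univ_succAbove _ p]
  simp only [Fin.prod_univ_succAbove _ p, lt_irrefl, if_false, one_mul, Finset.prod_mul_distrib,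
    (Fin.strictMono_succAbove p).lt_iff_lt]
  rw [← mul_assoc, ← hsign, ← Finset.prod_mul_distrib]
  rw [← Finset.prod_mul_distrib (f := fun a => if p.succAbove a < p then (-1 : R) else 1)]
  congr 1
  refine Finset.prod_congr rfl fun a _ => ?_
  rcases lt_or_gt_of_ne (Fin.succAbove_ne p a) with h | h
  · simp [h, h.not_gt]
  · simp [h, h.not_gt]

/-- Generalized Louck identity: for `m ≥ n − 1 ≥ 0`, the factorial Grothendieck polynomial of
the one-row partition `(m−n+1)` (padded with zeros to length `n`) satisfies
`G_{(m−n+1)}(x|y) = Σ_{i=1}^n [x_i|y]^m ∏_{j≠i} (1+βx_j)/(x_i − x_j)`. -/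
theorem stmt4 {F : Type*} [Field F] (n m : ℕ) (hn : 1 ≤ n) (hm : n - 1 ≤ m)
    (β : F) (y : ℕ → F) (x : Fin n → F) (hx : Function.Injective x) :
    Groth β y (fun j : Fin n => if (j : ℕ) = 0 then m + 1 - n else 0) x
      = ∑ i : Fin n, fpow β y (x i) m
          * ∏ j ∈ Finset.univ.erase i, (1 + β * x j) / (x i - x j) := by
  obtain ⟨N, rfl⟩ : ∃ N, n = N + 1 := ⟨n - 1, by omega⟩
  have hV : ∏ i, ∏ j ∈ Finset.Ioi i, (x i - x j) ≠ 0 :=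
    Finset.prod_ne_zero_iff.2 fun i _ => Finset.prod_ne_zero_iff.2 fun j hj =>
      sub_ne_zero.2 (hx.ne (Finset.mem_Ioi.1 hj).ne)
  rw [Groth, div_eq_iff hV, Matrix.det_succ_column_zero, Finset.sum_mul]
  refine Finset.sum_congr rfl fun p _ => ?_
  have hminor : (Matrix.of fun i j : Fin (N + 1) =>
      fpow β y (x i) ((if (j : ℕ) = 0 then m + 1 - (N + 1) else 0) + (N + 1 - 1 - (j : ℕ)))
        * (1 + β * x i) ^ (j : ℕ)).submatrix p.succAbove Fin.succ
      = Matrix.of fun a b : Fin N => (1 + β * x (p.succAbove a)) *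
        (Matrix.of fun a b : Fin N => fpow β y (x (p.succAbove a)) (N - 1 - (b : ℕ))
          * (1 + β * x (p.succAbove a)) ^ (b : ℕ)) a b := by
    ext a b
    have : N + 1 - 1 - ((b : ℕ) + 1) = N - 1 - (b : ℕ) := by omega
    simp only [Matrix.submatrix_apply, Matrix.of_apply, Fin.val_succ, Nat.add_eq_zero_iff,
      one_ne_zero, and_false, if_false, zero_add, this, pow_succ]
    ring
  have herase : ∏ j ∈ Finset.univ.erase p, (1 + β * x j) / (x p - x j)
      = ∏ a, (1 + β * x (p.succAbove a)) / (x p - x (p.succAbove a)) := by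
    rw [← Finset.compl_singleton, ← Fin.image_succAbove_univ,
      Finset.prod_image Fin.succAbove_right_injective.injOn]
  have hne : ∏ a, (x p - x (p.succAbove a)) ≠ 0 :=
    Finset.prod_ne_zero_iff.2 fun a _ => sub_ne_zero.2 (hx.ne (Fin.succAbove_ne p a).symm)
  have hm' : m + 1 - (N + 1) + N = m := by omega
  rw [hminor, Matrix.det_mul_column, det_fpow_mul_pow β y fun a => x (p.succAbove a),
    prod_Ioi_sub_succAbove x p, herase, Finset.prod_div_distrib]
  simp only [Matrix.of_apply, Fin.val_zero, if_true, Nat.add_sub_cancel, Nat.sub_zero, hm',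
    pow_zero, mul_one]
  field_simp
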